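/- Let Ω ⊆ ℝ², and let D₀, D₁ : ℝ → Set(ℝ²) be families of open subsets of ℝ² that are monotone in their parameter: c ≤ c' implies Dᵢ(c) ⊆ Dᵢ(c') for i = 0,1. Let P' ∈ Ω and let a, a', b' ∈ ℝ satisfy: a ≠ a', the point P' lies in the topological frontier of D₀(a') and in the topological frontier of D₁(b'), and D₀(a) ∪ D₁(b') = Ω. Then a' < a. -/

import Mathlib

/-- Lemma 5.1: with monotone families of open sets D₀, D₁, if P' ∈ Ω lies on the
frontier of D₀(a') and of D₁(b'), a ≠ a', and the pair (a, b') is admissible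
(D₀(a) ∪ D₁(b') = Ω), then a' < a. -/
theorem admissible_pair_parameter_lt
    (Ω : Set (EuclideanSpace ℝ (Fin 2)))
    (D₀ D₁ : ℝ → Set (EuclideanSpace ℝ (Fin 2)))
    (hopen₀ : ∀ c, IsOpen (D₀ c)) (hopen₁ : ∀ c, IsOpen (D₁ c))
    (hmono₀ : ∀ c c' : ℝ, c ≤ c' → D₀ c ⊆ D₀ c')
    (hmono₁ : ∀ c c' : ℝ, c ≤ c' → D₁ c ⊆ D₁ c')
    (P' : EuclideanSpace ℝ (Fin 2)) (hP' : P' ∈ Ω)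
    (a a' b' : ℝ) (hne : a ≠ a')
    (hfr₀ : P' ∈ frontier (D₀ a')) (hfr₁ : P' ∈ frontier (D₁ b'))
    (hadm : D₀ a ∪ D₁ b' = Ω) :
    a' < a := by
  rw [(hopen₀ a').frontier_eq] at hfr₀
  rw [(hopen₁ b').frontier_eq] at hfr₁
  have hmem : P' ∈ D₀ a := (hadm.symm ▸ hP' : P' ∈ D₀ a ∪ D₁ b').resolve_right hfr₁.2
  by_contra! hle
  exact hfr₀.2 (hmono₀ a a' hle hmem)
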